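/- Let k be a field, n ≥ 1, A = k[x₁,…,xₙ], and set R = A/(x₁x₂⋯xₙ), R₁ = A/(x₁), R₂ = A/(x₂⋯xₙ), R₁₂ = A/(x₁, x₂⋯xₙ). Let φ : Ω^i_R/tors → (Ω^i_{R₂}/tors) ⊕ Ω^i_{R₁} be the pair of canonical restriction maps, and let ψ : (Ω^i_{R₂}/tors) ⊕ Ω^i_{R₁} → Ω^i_{R₁₂}/tors be the difference of the canonical restriction maps. Then for every i ≥ 1 the kernel of ψ equals the image of φ; that is, the sequence is exact at the middle term. -/

import Mathlib

set_option maxHeartbeats 1000000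
set_option synthInstance.maxHeartbeats 400000

open ExteriorAlgebra MvPolynomial

noncomputable section

/-- `Ω^i_S`: the `i`-th exterior power (over `S`) of the module of Kähler differentials
of a `k`-algebra `S`. -/
abbrev OmegaPow (k : Type*) [CommRing k] (S : Type*) [CommRing S] [Algebra k S] (i : ℕ) :=
  ↥(⋀[S]^i (Ω[S⁄k]))

/-- The generator `s₀ • (d s₁ ∧ ⋯ ∧ d sᵢ)` of `Ω^i_S`. -/
def omegaGen (k : Type*) [CommRing k] (S : Type*) [CommRing S] [Algebra k S] (i : ℕ)
    (s₀ : S) (v : Fin i → S) : OmegaPow k S i :=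
  s₀ • ⟨ExteriorAlgebra.ιMulti S i (fun t => KaehlerDifferential.D k S (v t)),
    ExteriorAlgebra.ιMulti_range S i (Set.mem_range_self _)⟩

/-- `Ω^i_S / torsion`: the quotient of `Ω^i_S` by its torsion submodule (elements annihilated
by some nonzerodivisor). -/
abbrev OmegaPowModTors (k : Type*) [CommRing k] (S : Type*) [CommRing S] [Algebra k S]
    (i : ℕ) :=
  OmegaPow k S i ⧸ Submodule.torsion S (OmegaPow k S i)

/-- The class of the generator `s₀ • (d s₁ ∧ ⋯ ∧ d sᵢ)` in `Ω^i_S / torsion`. -/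
def omegaGenTors (k : Type*) [CommRing k] (S : Type*) [CommRing S] [Algebra k S] (i : ℕ)
    (s₀ : S) (v : Fin i → S) : OmegaPowModTors k S i :=
  Submodule.Quotient.mk (omegaGen k S i s₀ v)

/-- The polynomial ring `A = k[x₁, …, x_{n+1}]`. -/
abbrev polyA (k : Type*) [Field k] (n : ℕ) := MvPolynomial (Fin (n + 1)) k

/-- The ideal `(x₁ ⋯ x_{n+1})` of `A`. -/
abbrev idealR (k : Type*) [Field k] (n : ℕ) : Ideal (polyA k n) :=
  Ideal.span {∏ j, X j}

/-- The ideal `(x₁)` of `A`. -/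
abbrev idealR1 (k : Type*) [Field k] (n : ℕ) : Ideal (polyA k n) :=
  Ideal.span {X 0}

/-- The ideal `(x₂ ⋯ x_{n+1})` of `A`. -/
abbrev idealR2 (k : Type*) [Field k] (n : ℕ) : Ideal (polyA k n) :=
  Ideal.span {∏ j ∈ Finset.univ.erase 0, X j}

/-- The ideal `(x₁, x₂ ⋯ x_{n+1})` of `A`. -/
abbrev idealR12 (k : Type*) [Field k] (n : ℕ) : Ideal (polyA k n) :=
  Ideal.span {X 0, ∏ j ∈ Finset.univ.erase 0, X j}

/-- `R = A/(x₁ ⋯ x_{n+1})`, the coordinate ring of the simple normal crossing divisor `E`. -/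
abbrev ringR (k : Type*) [Field k] (n : ℕ) := polyA k n ⧸ idealR k n

/-- `R₁ = A/(x₁)`, the coordinate ring of the component `E₁`. -/
abbrev ringR1 (k : Type*) [Field k] (n : ℕ) := polyA k n ⧸ idealR1 k n

/-- `R₂ = A/(x₂ ⋯ x_{n+1})`, the coordinate ring of the union `E₁ᶜ` of the other
components. -/
abbrev ringR2 (k : Type*) [Field k] (n : ℕ) := polyA k n ⧸ idealR2 k n

/-- `R₁₂ = A/(x₁, x₂ ⋯ x_{n+1})`, the coordinate ring of the intersection `E₁ ∩ E₁ᶜ`. -/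
abbrev ringR12 (k : Type*) [Field k] (n : ℕ) := polyA k n ⧸ idealR12 k n

end

noncomputable section

section Functoriality

variable {k S T U : Type*} [CommRing k] [CommRing S] [CommRing T] [CommRing U]
  [Algebra k S] [Algebra k T] [Algebra k U]

/-- The semilinear map on Kähler differentials induced by a homomorphism of `k`-algebras. -/
def kaehlerMap (f : S →ₐ[k] T) : Ω[S⁄k] →ₛₗ[(f : S →+* T)] Ω[T⁄k] :=
  letI : Algebra S T := (f : S →+* T).toAlgebra
  haveI : IsScalarTower k S T := IsScalarTower.of_algebraMap_eq fun r => (f.commutes r).symm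
  { toFun := KaehlerDifferential.map k k S T
    map_add' := map_add _
    map_smul' := fun r x => by
      rw [map_smul, ← algebraMap_smul T r]
      rfl }

lemma kaehlerMap_D (f : S →ₐ[k] T) (s : S) :
    kaehlerMap f (KaehlerDifferential.D k S s) = KaehlerDifferential.D k T (f s) := by
  let _ : Algebra S T := (f : S →+* T).toAlgebra
  have : IsScalarTower k S T := IsScalarTower.of_algebraMap_eq fun r => (f.commutes r).symm
  exact KaehlerDifferential.map_D k k S T s

/-- A predicate on differentials that is stable under linear combinations holds as soon as it
holds for exact differentials. -/
lemma kaehler_induction {P : Ω[S⁄k] → Prop}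
    (hD : ∀ s, P (KaehlerDifferential.D k S s)) (h0 : P 0) (hadd : ∀ x y, P x → P y → P (x + y))
    (hsmul : ∀ (a : S) x, P x → P (a • x)) (x : Ω[S⁄k]) : P x := by
  have hx : x ∈ Submodule.span S (Set.range (KaehlerDifferential.D k S)) := by
    rw [KaehlerDifferential.span_range_derivation]; trivial
  induction hx using Submodule.span_induction with
  | mem y hy => obtain ⟨s, rfl⟩ := hy; exact hD s
  | zero => exact h0
  | add y z _ _ hy hz => exact hadd y z hy hz
  | smul a y _ hy => exact hsmul a y hy

lemma kaehlerMap_comp (g : T →ₐ[k] U) (f : S →ₐ[k] T) (x : Ω[S⁄k]) :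
    kaehlerMap g (kaehlerMap f x) = kaehlerMap (g.comp f) x := by
  induction x using kaehler_induction with
  | hD s => simp [kaehlerMap_D]
  | h0 => simp
  | hadd x y hx hy => simp [hx, hy]
  | hsmul a x hx => simp [hx]

lemma kaehlerMap_surjective (f : S →ₐ[k] T) (hf : Function.Surjective f) :
    Function.Surjective (kaehlerMap f) := by
  let _ : Algebra S T := (f : S →+* T).toAlgebra
  have : IsScalarTower k S T := IsScalarTower.of_algebraMap_eq fun r => (f.commutes r).symm
  exact KaehlerDifferential.map_surjective_of_surjective k k S T hf

/-- The semilinear map `Ω^i_S → Ω^i_T` induced by a homomorphism of `k`-algebras. -/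
def omegaMap (i : ℕ) (f : S →ₐ[k] T) : OmegaPow k S i →ₛₗ[(f : S →+* T)] OmegaPow k T i :=
  letI : Module S (OmegaPow k T i) := Module.compHom _ (f : S →+* T)
  let g : Ω[S⁄k] [⋀^Fin i]→ₗ[S] OmegaPow k T i :=
    { toFun := fun v => exteriorPower.ιMulti T i fun t => kaehlerMap f (v t)
      map_update_add' := fun v t x y => by
        have h : ∀ z, (fun s => kaehlerMap f (Function.update v t z s)) =
            Function.update (fun s => kaehlerMap f (v s)) t (kaehlerMap f z) := fun z => by
          ext1 s; rcases eq_or_ne s t with rfl | hs <;> simp [*]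
        simp only [h, map_add, AlternatingMap.map_update_add]
      map_update_smul' := fun v t a x => by
        have h : ∀ z, (fun s => kaehlerMap f (Function.update v t z s)) =
            Function.update (fun s => kaehlerMap f (v s)) t (kaehlerMap f z) := fun z => by
          ext1 s; rcases eq_or_ne s t with rfl | hs <;> simp [*]
        simp only [h, map_smulₛₗ, AlternatingMap.map_update_smul]
        rfl
      map_eq_zero_of_eq' := fun v s t hst hne =>
        AlternatingMap.map_eq_zero_of_eq _ _ (by simp [hst]) hne }
  { toFun := exteriorPower.alternatingMapLinearEquiv g
    map_add' := map_add _
    map_smul' := map_smul _ }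

lemma omegaMap_ιMulti (i : ℕ) (f : S →ₐ[k] T) (v : Fin i → Ω[S⁄k]) :
    omegaMap i f (exteriorPower.ιMulti S i v) =
      exteriorPower.ιMulti T i fun t => kaehlerMap f (v t) := by
  let _ : Module S (OmegaPow k T i) := Module.compHom _ (f : S →+* T)
  exact exteriorPower.alternatingMapLinearEquiv_apply_ιMulti _ v

lemma omegaMap_omegaGen (i : ℕ) (f : S →ₐ[k] T) (a : S) (v : Fin i → S) :
    omegaMap i f (omegaGen k S i a v) = omegaGen k T i (f a) fun t => f (v t) := by
  refine (map_smulₛₗ (omegaMap i f) a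
    (exteriorPower.ιMulti S i fun t => KaehlerDifferential.D k S (v t))).trans ?_
  rw [omegaMap_ιMulti]
  simp only [kaehlerMap_D]
  rfl

/-- A predicate on `i`-forms that is stable under linear combinations holds as soon as it holds
for pure wedge products. -/
lemma omega_induction {i : ℕ} {P : OmegaPow k S i → Prop}
    (hι : ∀ v, P (exteriorPower.ιMulti S i v)) (h0 : P 0)
    (hadd : ∀ x y, P x → P y → P (x + y))
    (hsmul : ∀ (a : S) x, P x → P (a • x)) (x : OmegaPow k S i) : P x := by
  have hx : x ∈ Submodule.span S (Set.range (exteriorPower.ιMulti S i (M := Ω[S⁄k]))) := by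
    rw [exteriorPower.ιMulti_span]; trivial
  induction hx using Submodule.span_induction with
  | mem y hy => obtain ⟨s, rfl⟩ := hy; exact hι s
  | zero => exact h0
  | add y z _ _ hy hz => exact hadd y z hy hz
  | smul a y _ hy => exact hsmul a y hy

lemma omegaMap_comp (i : ℕ) (g : T →ₐ[k] U) (f : S →ₐ[k] T) (x : OmegaPow k S i) :
    omegaMap i g (omegaMap i f x) = omegaMap i (g.comp f) x := by
  induction x using omega_induction with
  | hι v => simp only [omegaMap_ιMulti, kaehlerMap_comp]
  | h0 => simp
  | hadd x y hx hy => simp only [map_add, hx, hy]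
  | hsmul a x hx => simp only [map_smulₛₗ, hx]; rfl

lemma omegaMap_surjective (i : ℕ) (f : S →ₐ[k] T) (hf : Function.Surjective f) :
    Function.Surjective (omegaMap i f) := by
  intro y
  induction y using omega_induction with
  | hι v =>
    choose w hw using fun t => kaehlerMap_surjective f hf (v t)
    exact ⟨exteriorPower.ιMulti S i w, by simp only [omegaMap_ιMulti, hw]⟩
  | h0 => exact ⟨0, map_zero _⟩
  | hadd x y hx hy =>
    obtain ⟨x, rfl⟩ := hx
    obtain ⟨y, rfl⟩ := hy
    exact ⟨x + y, map_add _ _ _⟩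
  | hsmul a x hx =>
    obtain ⟨x, rfl⟩ := hx
    obtain ⟨a, rfl⟩ := hf a
    exact ⟨a • x, map_smulₛₗ _ _ _⟩

/-- If multiplication by `y` does not distinguish an endomorphism `e` from the identity of `S`,
then a power of `y` does not distinguish the action of `e` on `i`-forms from the identity. -/
lemma pow_smul_omegaMap (i : ℕ) (e : S →ₐ[k] S) (y : S) (hy : ∀ a, y * e a = y * a)
    (x : OmegaPow k S i) : y ^ (2 * i + 1) • omegaMap i e x = y ^ (2 * i + 1) • x := by
  have hK : ∀ v : Ω[S⁄k], y ^ 2 • kaehlerMap e v = y ^ 2 • v := by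
    intro v
    induction v using kaehler_induction with
    | hD s =>
      have h : y * (e s - s) = 0 := by rw [mul_sub, hy, sub_self]
      have h2 : y • KaehlerDifferential.D k S (y * (e s - s)) = 0 := by
        rw [h, map_zero, smul_zero]
      rw [Derivation.leibniz, smul_add, smul_smul, smul_smul, ← pow_two, h, zero_smul, add_zero] at h2
      rw [kaehlerMap_D, ← sub_eq_zero, ← smul_sub, ← map_sub, h2]
    | h0 => simp
    | hadd x y hx hy => simp only [map_add, smul_add, hx, hy]
    | hsmul a x hx =>
      have h : y ^ 2 * e a = a * y ^ 2 := by rw [pow_two, mul_assoc, hy]; ring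
      rw [map_smulₛₗ, smul_smul, smul_comm (y ^ 2) a x, ← hx, smul_smul, ← h]
      rfl
  induction x using omega_induction with
  | hι v =>
    have h : ∀ w : Fin i → Ω[S⁄k], y ^ (2 * i + 1) • exteriorPower.ιMulti S i w =
        y • exteriorPower.ιMulti S i fun t => y ^ 2 • w t := fun w => by
      rw [AlternatingMap.map_smul_univ _ (fun _ => y ^ 2) w, smul_smul]
      rw [Finset.prod_const, Finset.card_univ, Fintype.card_fin, ← pow_mul, pow_succ']
    simp only [omegaMap_ιMulti, h, hK]
  | h0 => simp
  | hadd x y hx hy => simp only [map_add, smul_add, hx, hy]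
  | hsmul a x hx =>
    have h : y ^ (2 * i + 1) * e a = a * y ^ (2 * i + 1) := by
      rw [pow_succ, mul_assoc, hy]; ring
    rw [map_smulₛₗ, smul_smul, smul_comm _ a x, ← hx, smul_smul, ← h]
    rfl

end Functoriality

section Torsion

variable {k : Type*} [Field k] {σ : Type*} [DecidableEq σ]

/-- The endomorphism of the polynomial ring that sets the variable `X j` to zero. -/
def setZero (k : Type*) [Field k] {σ : Type*} [DecidableEq σ] (j : σ) :
    MvPolynomial σ k →ₐ[k] MvPolynomial σ k :=
  aeval (Function.update X j 0)

lemma setZero_X_self (j : σ) : setZero k j (X j) = 0 := by simp [setZero]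

lemma setZero_X_of_ne {j l : σ} (h : l ≠ j) : setZero k j (X l) = X l := by simp [setZero, h]

lemma setZero_comm (j l : σ) (a : MvPolynomial σ k) :
    setZero k j (setZero k l a) = setZero k l (setZero k j a) := by
  suffices (setZero k j).comp (setZero k l) = (setZero k l).comp (setZero k j) from
    DFunLike.congr_fun this a
  ext1 m
  rcases eq_or_ne m j with rfl | hj <;> rcases eq_or_ne m l with rfl | hl <;>
    simp [setZero_X_self, setZero_X_of_ne, *]

lemma setZero_setZero (j : σ) (a : MvPolynomial σ k) :
    setZero k j (setZero k j a) = setZero k j a := by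
  suffices (setZero k j).comp (setZero k j) = setZero k j from DFunLike.congr_fun this a
  ext1 m
  by_cases h : m = j <;> simp [setZero, *]

lemma X_dvd_sub_setZero (j : σ) (a : MvPolynomial σ k) : X j ∣ a - setZero k j a := by
  rw [← Ideal.mem_span_singleton, ← Ideal.Quotient.mk_eq_mk_iff_sub_mem]
  suffices Ideal.Quotient.mkₐ k (Ideal.span {(X j : MvPolynomial σ k)}) =
      (Ideal.Quotient.mkₐ k (Ideal.span {X j})).comp (setZero k j) from DFunLike.congr_fun this a
  ext1 m
  by_cases h : m = j
  · subst h
    simp [setZero_X_self]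
  · simp [setZero_X_of_ne h]

lemma X_dvd_iff_setZero (j : σ) (a : MvPolynomial σ k) : X j ∣ a ↔ setZero k j a = 0 := by
  refine ⟨fun ⟨b, hb⟩ => by simp [hb, setZero_X_self], fun h => ?_⟩
  simpa [h] using X_dvd_sub_setZero j a

lemma prod_X_dvd_iff (J : Finset σ) (a : MvPolynomial σ k) :
    ∏ j ∈ J, X j ∣ a ↔ ∀ j ∈ J, setZero k j a = 0 := by
  simp only [← X_dvd_iff_setZero]
  refine ⟨fun h j hj => (Finset.dvd_prod_of_mem _ hj).trans h, fun h => ?_⟩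
  refine Finset.prod_dvd_of_isRelPrime (fun i _ j _ hij => ?_) h
  refine (X_prime.irreducible.isRelPrime_iff_not_dvd).mpr fun hd => ?_
  rw [X_dvd_iff_setZero, setZero_X_of_ne hij.symm] at hd
  exact X_ne_zero _ hd

/-- The ideal `I` is the ideal of the union of the coordinate subspaces `{X j = 0}`, `j ∈ J`,
inside the coordinate subspace onto which the endomorphism `ρ` retracts. -/
structure IsCrossingIdeal (I : Ideal (MvPolynomial σ k)) (J : Finset σ)
    (ρ : MvPolynomial σ k →ₐ[k] MvPolynomial σ k) : Prop where
  mem_iff : ∀ a, a ∈ I ↔ ∏ j ∈ J, X j ∣ ρ a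
  idem : ∀ a, ρ (ρ a) = ρ a
  comm : ∀ j ∈ J, ∀ a, ρ (setZero k j a) = setZero k j (ρ a)
  map_X : ∀ j ∈ J, ρ (X j) = X j

namespace IsCrossingIdeal

variable {I : Ideal (MvPolynomial σ k)} {J : Finset σ}
  {ρ : MvPolynomial σ k →ₐ[k] MvPolynomial σ k}

/-- Restriction to the component `{X j = 0}`, followed by the inclusion of its coordinate ring
into the polynomial ring. -/
def proj (h : IsCrossingIdeal I J ρ) (j : J) : MvPolynomial σ k ⧸ I →ₐ[k] MvPolynomial σ k :=
  Ideal.Quotient.liftₐ I ((setZero k (j : σ)).comp ρ) fun a ha =>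
    (prod_X_dvd_iff J _).mp ((h.mem_iff a).mp ha) j j.2

lemma proj_mk (h : IsCrossingIdeal I J ρ) (j : J) (a : MvPolynomial σ k) :
    h.proj j (Ideal.Quotient.mk I a) = setZero k (j : σ) (ρ a) := rfl

lemma eq_zero_of_proj (h : IsCrossingIdeal I J ρ) (s : MvPolynomial σ k ⧸ I)
    (hs : ∀ j, h.proj j s = 0) : s = 0 := by
  obtain ⟨a, rfl⟩ := Ideal.Quotient.mk_surjective s
  rw [Ideal.Quotient.eq_zero_iff_mem, h.mem_iff, prod_X_dvd_iff]
  exact fun j hj => hs ⟨j, hj⟩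

/-- The product of the equations of all components but one. -/
def coeff (_ : IsCrossingIdeal I J ρ) (j : J) : MvPolynomial σ k ⧸ I :=
  Ideal.Quotient.mk I (∏ l ∈ J.erase j, X l)

lemma proj_coeff_self (h : IsCrossingIdeal I J ρ) (j : J) : h.proj j (h.coeff j) ≠ 0 := by
  rw [coeff, proj_mk, map_prod, map_prod, Finset.prod_ne_zero_iff]
  intro l hl
  rw [h.map_X l (Finset.mem_of_mem_erase hl), setZero_X_of_ne (Finset.ne_of_mem_erase hl)]
  exact X_ne_zero l

lemma proj_coeff_of_ne (h : IsCrossingIdeal I J ρ) {j l : J} (hjl : j ≠ l) :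
    h.proj j (h.coeff l) = 0 := by
  rw [coeff, proj_mk, map_prod, map_prod]
  refine Finset.prod_eq_zero
    (Finset.mem_erase.mpr ⟨fun hh => hjl (Subtype.ext hh), j.2⟩) ?_
  rw [h.map_X j j.2, setZero_X_self]

lemma coeff_mul (h : IsCrossingIdeal I J ρ) (j : J) (s : MvPolynomial σ k ⧸ I) :
    h.coeff j * ((Ideal.Quotient.mkₐ k I).comp (h.proj j)) s = h.coeff j * s := by
  obtain ⟨a, rfl⟩ := Ideal.Quotient.mk_surjective s
  change Ideal.Quotient.mk I _ * Ideal.Quotient.mk I (setZero k (j : σ) (ρ a)) = _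
  rw [coeff, ← map_mul, ← map_mul, Eq.comm, Ideal.Quotient.mk_eq_mk_iff_sub_mem, h.mem_iff,
    ← mul_sub, map_mul, map_sub, h.comm j j.2, h.idem, map_prod,
    Finset.prod_congr rfl fun l hl => h.map_X l (Finset.mem_of_mem_erase hl),
    ← Finset.prod_erase_mul J _ j.2]
  exact mul_dvd_mul_left _ (X_dvd_sub_setZero _ _)

/-- A differential form on a crossing divisor is torsion if and only if it vanishes on every
component. -/
lemma mem_torsion_iff (h : IsCrossingIdeal I J ρ) (i : ℕ)
    (x : OmegaPow k (MvPolynomial σ k ⧸ I) i) :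
    x ∈ Submodule.torsion (MvPolynomial σ k ⧸ I) (OmegaPow k (MvPolynomial σ k ⧸ I) i) ↔
      ∀ j, omegaMap i (h.proj j) x = 0 := by
  rw [Submodule.mem_torsion_iff]
  constructor
  · rintro ⟨⟨g, hg⟩, hgx⟩ j
    have hgj : h.proj j g ≠ 0 := fun hz => by
      refine h.proj_coeff_self j ?_
      rw [(mem_nonZeroDivisors_iff_right.mp hg) (h.coeff j) (h.eq_zero_of_proj _ fun l => ?_),
        map_zero]
      rcases eq_or_ne l j with rfl | hlj
      · rw [map_mul, hz, mul_zero]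
      · rw [map_mul, h.proj_coeff_of_ne hlj, zero_mul]
    have := congrArg (omegaMap i (h.proj j)) (show g • x = 0 from hgx)
    rw [map_smulₛₗ, map_zero] at this
    exact (smul_eq_zero_iff_right hgj).mp this
  · intro hx
    refine ⟨⟨∑ j, h.coeff j ^ (2 * i + 1), ?_⟩, ?_⟩
    · refine mem_nonZeroDivisors_iff_right.mpr fun c hc => h.eq_zero_of_proj _ fun j => ?_
      have := congrArg (h.proj j) hc
      rw [map_mul, map_sum, map_zero, Finset.sum_eq_single j, map_pow] at this
      · exact (mul_eq_zero.mp this).resolve_right (pow_ne_zero _ (h.proj_coeff_self j))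
      · intro l _ hl
        rw [map_pow, h.proj_coeff_of_ne hl.symm, zero_pow (by simp)]
      · simp
    · change (∑ j, h.coeff j ^ (2 * i + 1)) • x = 0
      rw [Finset.sum_smul]
      refine Finset.sum_eq_zero fun j _ => ?_
      rw [← pow_smul_omegaMap i _ _ (h.coeff_mul j), ← omegaMap_comp, hx j, map_zero, smul_zero]

lemma torsion_le_comap (h : IsCrossingIdeal I J ρ) {I' : Ideal (MvPolynomial σ k)} {J' : Finset σ}
    {ρ' : MvPolynomial σ k →ₐ[k] MvPolynomial σ k} (h' : IsCrossingIdeal I' J' ρ') (hI : I ≤ I')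
    (hproj : ∀ j' : J', ∃ (j : J) (τ : MvPolynomial σ k →ₐ[k] MvPolynomial σ k),
      ∀ a, setZero k (j' : σ) (ρ' a) = τ (setZero k (j : σ) (ρ a))) (i : ℕ) :
    Submodule.torsion (MvPolynomial σ k ⧸ I) (OmegaPow k (MvPolynomial σ k ⧸ I) i) ≤
      (Submodule.torsion (MvPolynomial σ k ⧸ I') (OmegaPow k (MvPolynomial σ k ⧸ I') i)).comap
        (omegaMap i (Ideal.Quotient.factorₐ k hI)) := by
  intro x hx
  rw [Submodule.mem_comap, h'.mem_torsion_iff]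
  intro j'
  obtain ⟨j, τ, hτ⟩ := hproj j'
  have hcomp : (h'.proj j').comp (Ideal.Quotient.factorₐ k hI) = τ.comp (h.proj j) :=
    Ideal.Quotient.algHom_ext _ (AlgHom.ext hτ)
  rw [omegaMap_comp, hcomp, ← omegaMap_comp, (h.mem_torsion_iff i x).mp hx j, map_zero]

lemma omegaMap_mk_mem_torsion_iff (h : IsCrossingIdeal I J ρ) (i : ℕ)
    (x : OmegaPow k (MvPolynomial σ k) i) :
    omegaMap i (Ideal.Quotient.mkₐ k I) x ∈
        Submodule.torsion (MvPolynomial σ k ⧸ I) (OmegaPow k (MvPolynomial σ k ⧸ I) i) ↔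
      ∀ j : J, omegaMap i ((setZero k (j : σ)).comp ρ) x = 0 := by
  rw [h.mem_torsion_iff]
  simp only [omegaMap_comp]
  rfl

end IsCrossingIdeal

lemma isCrossingIdeal_span_prod (J : Finset σ) :
    IsCrossingIdeal (Ideal.span {∏ j ∈ J, (X j : MvPolynomial σ k)}) J (AlgHom.id k _) where
  mem_iff _ := Ideal.mem_span_singleton
  idem _ := rfl
  comm _ _ _ := rfl
  map_X _ _ := rfl

lemma isCrossingIdeal_span_pair (l : σ) (J : Finset σ) (hl : l ∉ J) :
    IsCrossingIdeal (Ideal.span {X l, ∏ j ∈ J, (X j : MvPolynomial σ k)}) J (setZero k l) where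
  mem_iff a := by
    rw [Ideal.mem_span_pair]
    constructor
    · rintro ⟨u, v, rfl⟩
      rw [map_add, map_mul, map_mul, setZero_X_self, mul_zero, zero_add, map_prod,
        Finset.prod_congr rfl fun j hj =>
          setZero_X_of_ne (j := l) (l := j) (ne_of_mem_of_not_mem hj hl)]
      exact dvd_mul_left _ _
    · rintro ⟨v, hv⟩
      obtain ⟨u, hu⟩ := X_dvd_sub_setZero l a
      exact ⟨u, v, by rw [mul_comm u, mul_comm v, ← hu, ← hv, sub_add_cancel]⟩
  idem := setZero_setZero l
  comm j _ a := setZero_comm l j a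
  map_X j hj := setZero_X_of_ne (ne_of_mem_of_not_mem hj hl)

end Torsion

section Crossing

variable (k : Type*) [Field k] (n : ℕ)

lemma isCrossingIdeal_idealR : IsCrossingIdeal (idealR k n) Finset.univ (AlgHom.id k _) :=
  isCrossingIdeal_span_prod _

lemma isCrossingIdeal_idealR1 : IsCrossingIdeal (idealR1 k n) {0} (AlgHom.id k _) := by
  simpa using isCrossingIdeal_span_prod (k := k) ({0} : Finset (Fin (n + 1)))

lemma isCrossingIdeal_idealR2 :
    IsCrossingIdeal (idealR2 k n) (Finset.univ.erase 0) (AlgHom.id k _) :=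
  isCrossingIdeal_span_prod _

lemma isCrossingIdeal_idealR12 :
    IsCrossingIdeal (idealR12 k n) (Finset.univ.erase 0) (setZero k 0) :=
  isCrossingIdeal_span_pair _ _ (by simp)

lemma idealR_le_idealR1 : idealR k n ≤ idealR1 k n :=
  Ideal.span_singleton_le_span_singleton.mpr (Finset.dvd_prod_of_mem _ (Finset.mem_univ 0))

lemma idealR_le_idealR2 : idealR k n ≤ idealR2 k n :=
  Ideal.span_singleton_le_span_singleton.mpr
    (Finset.prod_dvd_prod_of_subset _ _ _ (Finset.erase_subset _ _))

lemma idealR1_le_idealR12 : idealR1 k n ≤ idealR12 k n := Ideal.span_mono (by simp)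

lemma idealR2_le_idealR12 : idealR2 k n ≤ idealR12 k n := Ideal.span_mono (by simp)

lemma mkₐ_comp_setZero :
    (Ideal.Quotient.mkₐ k (idealR1 k n)).comp (setZero k 0) = Ideal.Quotient.mkₐ k _ :=
  AlgHom.ext fun a => ((Ideal.Quotient.mk_eq_mk_iff_sub_mem _ _).mpr
    (Ideal.mem_span_singleton.mpr (X_dvd_sub_setZero 0 a))).symm

/-- The forms on a coordinate hyperplane are torsion-free. -/
lemma torsion_ringR1 (i : ℕ) :
    Submodule.torsion (ringR1 k n) (OmegaPow k (ringR1 k n) i) = ⊥ := by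
  refine (Submodule.eq_bot_iff _).mpr fun x hx => ?_
  obtain ⟨x, rfl⟩ := omegaMap_surjective i _ (Ideal.Quotient.mkₐ_surjective k (idealR1 k n)) x
  rw [(isCrossingIdeal_idealR1 k n).omegaMap_mk_mem_torsion_iff] at hx
  have h0 : omegaMap i (setZero k 0) x = 0 := hx ⟨0, by simp⟩
  rw [← mkₐ_comp_setZero, ← omegaMap_comp, h0, map_zero]

/-- The restriction `Ω^i_R/tors → Ω^i_{R₂}/tors`. -/
def restrictR2 (i : ℕ) : OmegaPowModTors k (ringR k n) i →+ OmegaPowModTors k (ringR2 k n) i :=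
  (Submodule.mapQ _ _ (omegaMap i (Ideal.Quotient.factorₐ k (idealR_le_idealR2 k n)))
    ((isCrossingIdeal_idealR k n).torsion_le_comap (isCrossingIdeal_idealR2 k n) _
      (fun j => ⟨⟨j, Finset.mem_univ _⟩, AlgHom.id k _, fun _ => rfl⟩) i)).toAddMonoidHom

/-- The restriction `Ω^i_R/tors → Ω^i_{R₁}`. -/
def restrictR1 (i : ℕ) : OmegaPowModTors k (ringR k n) i →+ OmegaPow k (ringR1 k n) i :=
  (Submodule.liftQ _ (omegaMap i (Ideal.Quotient.factorₐ k (idealR_le_idealR1 k n)))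
    (((isCrossingIdeal_idealR k n).torsion_le_comap (isCrossingIdeal_idealR1 k n) _
      (fun j => ⟨⟨j, Finset.mem_univ _⟩, AlgHom.id k _, fun _ => rfl⟩) i).trans
      (by rw [torsion_ringR1]; rfl))).toAddMonoidHom

/-- The restriction `Ω^i_{R₂}/tors → Ω^i_{R₁₂}/tors`. -/
def restrictR2R12 (i : ℕ) :
    OmegaPowModTors k (ringR2 k n) i →+ OmegaPowModTors k (ringR12 k n) i :=
  (Submodule.mapQ _ _ (omegaMap i (Ideal.Quotient.factorₐ k (idealR2_le_idealR12 k n)))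
    ((isCrossingIdeal_idealR2 k n).torsion_le_comap (isCrossingIdeal_idealR12 k n) _
      (fun j => ⟨j, setZero k 0, fun _ => setZero_comm _ _ _⟩) i)).toAddMonoidHom

/-- The restriction `Ω^i_{R₁} → Ω^i_{R₁₂}/tors`. -/
def restrictR1R12 (i : ℕ) :
    OmegaPow k (ringR1 k n) i →+ OmegaPowModTors k (ringR12 k n) i :=
  ((Submodule.mkQ _).comp
    (omegaMap i (Ideal.Quotient.factorₐ k (idealR1_le_idealR12 k n)))).toAddMonoidHom

variable {k n} {i : ℕ}

/-- The class modulo torsion of the restriction of a form on affine space to a quotient ring. -/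
def formClass (I : Ideal (polyA k n)) (x : OmegaPow k (polyA k n) i) :
    OmegaPowModTors k (polyA k n ⧸ I) i :=
  Submodule.Quotient.mk (omegaMap i (Ideal.Quotient.mkₐ k I) x)

lemma formClass_surjective (I : Ideal (polyA k n)) :
    Function.Surjective (formClass (i := i) I) :=
  (Submodule.Quotient.mk_surjective _).comp
    (omegaMap_surjective i _ (Ideal.Quotient.mkₐ_surjective k I))

lemma formClass_sub (I : Ideal (polyA k n)) (x y : OmegaPow k (polyA k n) i) :
    formClass I (x - y) = formClass I x - formClass I y := by
  rw [formClass, map_sub]; rfl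

lemma restrictR2_formClass (x : OmegaPow k (polyA k n) i) :
    restrictR2 k n i (formClass _ x) = formClass _ x :=
  congrArg Submodule.Quotient.mk (omegaMap_comp i _ _ x)

lemma restrictR1_formClass (x : OmegaPow k (polyA k n) i) :
    restrictR1 k n i (formClass _ x) = omegaMap i (Ideal.Quotient.mkₐ k _) x :=
  omegaMap_comp i _ _ x

lemma restrictR2R12_formClass (x : OmegaPow k (polyA k n) i) :
    restrictR2R12 k n i (formClass _ x) = formClass _ x :=
  congrArg Submodule.Quotient.mk (omegaMap_comp i _ _ x)

lemma restrictR1R12_omegaMap (x : OmegaPow k (polyA k n) i) :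
    restrictR1R12 k n i (omegaMap i (Ideal.Quotient.mkₐ k _) x) = formClass _ x :=
  congrArg Submodule.Quotient.mk (omegaMap_comp i _ _ x)

/-- A form whose restriction to `E₁ ∩ E₁ᶜ` is torsion has torsion restriction to `E₁ᶜ` after
being pulled back along the projection onto `E₁`. -/
lemma formClass_setZero_eq_zero {x : OmegaPow k (polyA k n) i}
    (hx : formClass (idealR12 k n) x = 0) :
    formClass (idealR2 k n) (omegaMap i (setZero k 0) x) = 0 := by
  rw [formClass, Submodule.Quotient.mk_eq_zero,
    (isCrossingIdeal_idealR12 k n).omegaMap_mk_mem_torsion_iff] at hx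
  rw [formClass, Submodule.Quotient.mk_eq_zero,
    (isCrossingIdeal_idealR2 k n).omegaMap_mk_mem_torsion_iff]
  intro j
  rw [omegaMap_comp]
  exact hx j

lemma omegaMap_mk_setZero (x : OmegaPow k (polyA k n) i) :
    omegaMap i (Ideal.Quotient.mkₐ k (idealR1 k n)) (omegaMap i (setZero k 0) x) =
      omegaMap i (Ideal.Quotient.mkₐ k (idealR1 k n)) x := by
  rw [omegaMap_comp, mkₐ_comp_setZero]

end Crossing

end


/-- **Claims 3 and 4 of the appendix Theorem.**  For every `i ≥ 1`, with
`φ : Ω^i_R/tors → (Ω^i_{R₂}/tors) ⊕ Ω^i_{R₁}` the pair of canonical restriction maps and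
`ψ : (Ω^i_{R₂}/tors) ⊕ Ω^i_{R₁} → Ω^i_{R₁₂}/tors` the difference of the canonical
restriction maps, the kernel of `ψ` equals the image of `φ`; that is, the sequence is exact
at the middle term (`Function.Exact φ ψ`).  The maps `φ` and `ψ` are pinned down by their
values on the generators `a₀ • (d a₁ ∧ ⋯ ∧ d a_i)` (images of elements of `A`), which
generate the modules in question. -/
theorem stmt6 (k : Type*) [Field k] (n i : ℕ) (hi : 1 ≤ i) :
    ∃ (φ : OmegaPowModTors k (ringR k n) i →+
        (OmegaPowModTors k (ringR2 k n) i) × (OmegaPow k (ringR1 k n) i))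
      (ψ : (OmegaPowModTors k (ringR2 k n) i) × (OmegaPow k (ringR1 k n) i) →+
        OmegaPowModTors k (ringR12 k n) i),
      (∀ (a₀ : polyA k n) (v : Fin i → polyA k n),
        φ (omegaGenTors k (ringR k n) i (Ideal.Quotient.mk (idealR k n) a₀)
            fun t => Ideal.Quotient.mk (idealR k n) (v t))
          = (omegaGenTors k (ringR2 k n) i (Ideal.Quotient.mk (idealR2 k n) a₀)
               fun t => Ideal.Quotient.mk (idealR2 k n) (v t),
             omegaGen k (ringR1 k n) i (Ideal.Quotient.mk (idealR1 k n) a₀)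
               fun t => Ideal.Quotient.mk (idealR1 k n) (v t))) ∧
      (∀ (a₀ : polyA k n) (v : Fin i → polyA k n),
        ψ (omegaGenTors k (ringR2 k n) i (Ideal.Quotient.mk (idealR2 k n) a₀)
             fun t => Ideal.Quotient.mk (idealR2 k n) (v t), 0)
          = omegaGenTors k (ringR12 k n) i (Ideal.Quotient.mk (idealR12 k n) a₀)
              fun t => Ideal.Quotient.mk (idealR12 k n) (v t)) ∧
      (∀ (a₀ : polyA k n) (v : Fin i → polyA k n),
        ψ (0, omegaGen k (ringR1 k n) i (Ideal.Quotient.mk (idealR1 k n) a₀)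
             fun t => Ideal.Quotient.mk (idealR1 k n) (v t))
          = - omegaGenTors k (ringR12 k n) i (Ideal.Quotient.mk (idealR12 k n) a₀)
              fun t => Ideal.Quotient.mk (idealR12 k n) (v t)) ∧
      Function.Exact φ ψ := by
  refine ⟨(restrictR2 k n i).prod (restrictR1 k n i),
    (restrictR2R12 k n i).comp (AddMonoidHom.fst _ _) -
      (restrictR1R12 k n i).comp (AddMonoidHom.snd _ _), fun a₀ v => ?_, fun a₀ v => ?_,
    fun a₀ v => ?_, ?_⟩
  · exact Prod.ext (congrArg Submodule.Quotient.mk (omegaMap_omegaGen i _ _ _))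
      (omegaMap_omegaGen i _ _ _)
  · simp only [AddMonoidHom.sub_apply, AddMonoidHom.comp_apply, AddMonoidHom.coe_fst,
      AddMonoidHom.coe_snd, map_zero, sub_zero]
    exact congrArg Submodule.Quotient.mk (omegaMap_omegaGen i _ _ _)
  · simp only [AddMonoidHom.sub_apply, AddMonoidHom.comp_apply, AddMonoidHom.coe_fst,
      AddMonoidHom.coe_snd, map_zero, zero_sub]
    exact congrArg (fun x => -Submodule.Quotient.mk x) (omegaMap_omegaGen i _ _ _)
  · rintro ⟨a, b⟩
    obtain ⟨α, rfl⟩ := formClass_surjective _ a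
    obtain ⟨β, rfl⟩ := omegaMap_surjective i _ (Ideal.Quotient.mkₐ_surjective k (idealR1 k n)) b
    simp only [AddMonoidHom.sub_apply, AddMonoidHom.comp_apply, AddMonoidHom.coe_fst,
      AddMonoidHom.coe_snd, restrictR2R12_formClass, restrictR1R12_omegaMap, Set.mem_range,
      AddMonoidHom.prod_apply, Prod.mk.injEq]
    constructor
    · intro h
      rw [← formClass_sub] at h
      refine ⟨formClass _ (α - omegaMap i (setZero k 0) (α - β)), ?_, ?_⟩
      · rw [restrictR2_formClass, formClass_sub, formClass_setZero_eq_zero h, sub_zero]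
      · rw [restrictR1_formClass, map_sub, omegaMap_mk_setZero, ← map_sub, sub_sub_cancel]
    · rintro ⟨c, hα, hβ⟩
      obtain ⟨γ, rfl⟩ := formClass_surjective _ c
      rw [restrictR2_formClass] at hα
      rw [restrictR1_formClass] at hβ
      rw [← restrictR2R12_formClass, ← hα, ← restrictR1R12_omegaMap, ← hβ,
        restrictR2R12_formClass, restrictR1R12_omegaMap, sub_self]
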